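/- arXiv:2412.19383 — 6 statements merged into one kernel-verified Lean document; each statement's English description precedes it below -/
import Mathlib

section
/- Let p be a prime number and let R be an associative unital ring containing a central element π satisfying π^(p-1) = -(p·1). Then for any two (possibly non-commuting) elements α, β of R there exists γ ∈ R such that (1 + π·α + π²·β)^p = 1 + π^p·(α^p − α) + π^(p+1)·γ. -/
/-- Powers of `α + π β` agree with powers of `α` modulo the central element `π`. -/
theorem aux_pow {R : Type*} [Ring R] (π : R) (hc : ∀ x : R, π * x = x * π) (α β : R) (n : ℕ) :
    ∃ t : R, (α + π * β) ^ n = α ^ n + π * t := by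
  induction n with
  | zero => exact ⟨0, by simp⟩
  | succ n ih =>
    obtain ⟨t, ht⟩ := ih
    refine ⟨α ^ n * β + t * (α + π * β), ?_⟩
    rw [pow_succ, ht, pow_succ]
    have h : α ^ n * (π * β) = π * (α ^ n * β) := by
      rw [← mul_assoc, ← hc, mul_assoc]
    rw [add_mul, mul_add, h, mul_add π, mul_assoc, add_assoc]

/-- Lemma 5.1 of the paper: for a prime `p`, a ring `R`, and a central element `π`
with `π ^ (p - 1) = -(p : R)`, for any two (possibly non-commuting) elements `α β : R`
we have `(1 + π α + π² β) ^ p = 1 + π ^ p (α ^ p - α) + π ^ (p + 1) γ` for some `γ`. -/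
theorem lemma_5_1 {R : Type*} [Ring R] (p : ℕ) (hp : p.Prime) (π : R)
    (hcentral : ∀ x : R, π * x = x * π) (hπ : π ^ (p - 1) = -(p : R)) (α β : R) :
    ∃ γ : R, (1 + π * α + π ^ 2 * β) ^ p = 1 + π ^ p * (α ^ p - α) + π ^ (p + 1) * γ := by
  obtain ⟨t, ht⟩ := aux_pow π hcentral α β p
  set u := α + π * β with hu
  have h1 : 1 + π * α + π ^ 2 * β = π * u + 1 := by
    rw [hu]; noncomm_ring
  have hpu : ∀ k, (π * u) ^ k = π ^ k * u ^ k := fun k =>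
    Commute.mul_pow (hcentral u) k
  have hbin := Commute.add_pow_prime_eq' hp (Commute.one_right (π * u))
  have hs : ∃ s : R, ∑ k ∈ Finset.Ioo 0 p, (π * u) ^ k * 1 ^ (p - k) * ((p.choose k / p : ℕ) : R)
      = π * u + π ^ 2 * s := by
    have hset : Finset.Ioo 0 p = insert 1 (Finset.Ioo 1 p) := by
      have := hp.two_le
      ext k; simp only [Finset.mem_Ioo, Finset.mem_insert]; omega
    refine ⟨∑ k ∈ Finset.Ioo 1 p, π ^ (k - 2) * u ^ k * ((p.choose k / p : ℕ) : R), ?_⟩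
    rw [hset, Finset.sum_insert (by simp), Finset.mul_sum]
    congr 1
    · simp [Nat.div_self hp.pos]
    · refine Finset.sum_congr rfl fun k hk => ?_
      have hk2 : k = 2 + (k - 2) := by
        have := (Finset.mem_Ioo.1 hk).1; omega
      rw [hpu, one_pow, mul_one, ← mul_assoc, ← mul_assoc, ← pow_add, ← hk2]
  obtain ⟨s, hs⟩ := hs
  obtain ⟨q, rfl⟩ : ∃ q, p = q + 1 := ⟨p - 1, by have := hp.pos; omega⟩
  have hq : ((q + 1 : ℕ) : R) = - π ^ q := by
    rw [Nat.add_sub_cancel] at hπ; rw [hπ, neg_neg]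
  refine ⟨t - β - s, ?_⟩
  rw [h1, hbin, hs, hpu, ht, hq, one_pow, hu, pow_succ π (q + 1), pow_succ π q]
  simp only [mul_add, mul_sub, neg_mul, pow_two, mul_assoc]
  abel
end

section
/- Let p be a prime number and let R be a commutative ring containing an element π satisfying π^(p-1) = -(p·1). Then for any s ∈ R there exists γ ∈ R such that (1 + π·s)^p = 1 + π^p·(s^p − s) + π^(p+1)·γ. -/
/-- Commutative specialization of Lemma 5.1: for a prime `p`, a commutative ring `R`,
and `π : R` with `π ^ (p - 1) = -(p : R)`, for every `s : R` we have
`(1 + π s) ^ p = 1 + π ^ p (s ^ p - s) + π ^ (p + 1) γ` for some `γ`. -/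
theorem lemma_5_1_comm {R : Type*} [CommRing R] (p : ℕ) (hp : p.Prime) (π : R)
    (hπ : π ^ (p - 1) = -(p : R)) (s : R) :
    ∃ γ : R, (1 + π * s) ^ p = 1 + π ^ p * (s ^ p - s) + π ^ (p + 1) * γ := by
  have h2 := hp.two_le
  have key := add_pow_prime_eq hp (π * s) (1 : R)
  have hdvd : π ∣ (∑ k ∈ Finset.Ioo 0 p,
      (π * s) ^ (k - 1) * (1 : R) ^ (p - k - 1) * ((p.choose k / p : ℕ) : R)) - 1 := by
    have hmem : 1 ∈ Finset.Ioo 0 p := by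
      rw [Finset.mem_Ioo]; omega
    rw [← Finset.add_sum_erase _ _ hmem]
    have h1 : (π * s) ^ (1 - 1) * (1 : R) ^ (p - 1 - 1) * ((p.choose 1 / p : ℕ) : R) = 1 := by
      simp [Nat.div_self hp.pos]
    rw [h1, add_sub_cancel_left]
    refine Finset.dvd_sum fun k hk => ?_
    have hk' : k - 1 ≠ 0 := by
      simp only [Finset.mem_erase, Finset.mem_Ioo] at hk
      omega
    exact Dvd.dvd.mul_right (Dvd.dvd.mul_right
      ((Dvd.intro _ rfl : π ∣ π * s).trans (dvd_pow_self _ hk')) _) _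
  obtain ⟨c, hc⟩ := hdvd
  rw [sub_eq_iff_eq_add] at hc
  rw [hc] at key
  have hP : (p : R) = -π ^ (p - 1) := by rw [hπ, neg_neg]
  have hpp : π ^ p = π ^ (p - 1) * π := by
    rw [← pow_succ, Nat.sub_add_cancel hp.one_le]
  refine ⟨-(s * c), ?_⟩
  rw [add_comm, key, hP, mul_pow, one_pow, pow_succ, hpp]
  ring
end

section
/- Let p be a prime, R a commutative ring of characteristic p, N a natural number, and A an N×N matrix with entries in the polynomial ring R[X]. Define the operators ∇ and ∇^L on N-tuples of polynomials f = (f_1,…,f_N) ∈ (R[X])^N by (∇ f)_i = f_i′ + Σ_j A_{ij}·f_j and (∇^L f)_i = X·(∇ f)_i. Then for every f ∈ (R[X])^N one has ((∇^L)^p f)_i − (∇^L f)_i = X^p·((∇)^p f)_i for all i, where the powers denote p-fold iteration of the operators. -/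
open Polynomial

/-- The connection `∇ = ∂ + A` acting on `N`-tuples of polynomials. -/
noncomputable def conn {R : Type*} [CommRing R] {N : ℕ} (A : Matrix (Fin N) (Fin N) R[X])
    (f : Fin N → R[X]) : Fin N → R[X] :=
  fun i => derivative (f i) + ∑ j, A i j * f j

/-- The logarithmic connection `∇^L = X·∇` acting on `N`-tuples of polynomials. -/
noncomputable def connL {R : Type*} [CommRing R] {N : ℕ} (A : Matrix (Fin N) (Fin N) R[X])
    (f : Fin N → R[X]) : Fin N → R[X] :=
  fun i => X * conn A f i

theorem descPochhammer_zmod (p : ℕ) [Fact p.Prime] :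
    descPochhammer (ZMod p) p = X ^ p - X := by
  have hp1 : 1 < p := (Fact.out : p.Prime).one_lt
  have hm := monic_descPochhammer (ZMod p) p
  have hd : (descPochhammer (ZMod p) p).natDegree = p := descPochhammer_natDegree (ZMod p) p
  have hd2 := FiniteField.X_pow_card_sub_X_natDegree_eq (ZMod p) hp1
  have hm2 : (X ^ p - X : (ZMod p)[X]).Monic := by
    apply monic_X_pow_sub
    rw [degree_X]
    exact_mod_cast hp1
  refine eq_of_degree_sub_lt_of_eval_finset_eq (Finset.univ : Finset (ZMod p)) ?_ ?_
  · rw [Finset.card_univ, ZMod.card]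
    refine (degree_sub_lt_left ?_ hm.ne_zero ?_).trans_le ?_
    · rw [degree_eq_natDegree hm.ne_zero, degree_eq_natDegree hm2.ne_zero, hd, hd2]
    · rw [hm.leadingCoeff, hm2.leadingCoeff]
    · rw [degree_eq_natDegree hm.ne_zero, hd]
  · intro x _
    have h := descPochhammer_eval_coe_nat_of_lt (R := ZMod p) (ZMod.val_lt x)
    rw [ZMod.natCast_zmod_val] at h
    rw [h]
    simp [ZMod.pow_card]

theorem descPochhammer_charP (R : Type*) [CommRing R] (p : ℕ) (hp : p.Prime) [CharP R p] :
    descPochhammer R p = X ^ p - X := by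
  have : Fact p.Prime := ⟨hp⟩
  have h := congrArg (Polynomial.map (ZMod.castHom (dvd_refl p) R)) (descPochhammer_zmod p)
  rw [descPochhammer_map] at h
  simpa using h

/-- `connL` as a linear map. -/
noncomputable def connLLin {R : Type*} [CommRing R] {N : ℕ} (A : Matrix (Fin N) (Fin N) R[X]) :
    Module.End R (Fin N → R[X]) where
  toFun := connL A
  map_add' f g := by
    ext1 i
    simp only [connL, conn, Pi.add_apply, derivative_add, mul_add, Finset.sum_add_distrib]
    ring
  map_smul' c f := by
    ext1 i
    simp only [connL, conn, Pi.smul_apply, derivative_smul, mul_smul_comm, ← Finset.smul_sum,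
      ← smul_add, RingHom.id_apply]

theorem connL_X_pow {R : Type*} [CommRing R] {N : ℕ} (A : Matrix (Fin N) (Fin N) R[X])
    (n : ℕ) (g : Fin N → R[X]) (i : Fin N) :
    connL A (fun j => X ^ n * g j) i = (n : R[X]) * (X ^ n * g i) + X ^ (n + 1) * conn A g i := by
  have h : ∑ j, A i j * (X ^ n * g j) = X ^ n * ∑ j, A i j * g j := by
    rw [Finset.mul_sum]
    exact Finset.sum_congr rfl fun j _ => by ring
  simp only [connL, conn, h, derivative_mul, derivative_X_pow]
  cases n with
  | zero => simp
  | succ n => simp; ring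

theorem aeval_connL {R : Type*} [CommRing R] {N : ℕ} (A : Matrix (Fin N) (Fin N) R[X])
    (f : Fin N → R[X]) (n : ℕ) :
    aeval (connLLin A) (descPochhammer R n) f = fun i => X ^ n * ((conn A)^[n] f) i := by
  induction n with
  | zero => simp
  | succ n ih =>
    rw [descPochhammer_succ_right, mul_comm, map_mul, Module.End.mul_apply, ih]
    ext1 i
    have h := connL_X_pow A n ((conn A)^[n] f) i
    rw [Function.iterate_succ_apply']
    have h2 : connLLin A (fun i => X ^ n * ((conn A)^[n] f) i) i = _ := h
    simp [h2]

/-- Lemma 5.2 of the paper: in characteristic `p`, `(∇^L)^p - ∇^L = X^p ∇^p`. -/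
theorem lemma_5_2 {R : Type*} [CommRing R] (p : ℕ) (hp : p.Prime) [CharP R p]
    (N : ℕ) (A : Matrix (Fin N) (Fin N) R[X]) (f : Fin N → R[X]) (i : Fin N) :
    ((connL A)^[p] f) i - (connL A f) i = X ^ p * ((conn A)^[p] f) i := by
  have h := congrFun (aeval_connL A f p) i
  rw [descPochhammer_charP R p hp] at h
  rw [← h]
  simp only [map_sub, map_pow, aeval_X, LinearMap.sub_apply, Pi.sub_apply, Module.End.pow_apply]
  rfl
end

section
/- Let p be a prime number and let k be a natural number with k ≥ 2. Then p divides the integer Σ_{j=0}^{k} (−1)^{k−j}·binom(k,j)·j^p. -/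
/-- Key divisibility from the proof of Lemma 5.2: for a prime `p` and `k ≥ 2`,
`p` divides `∑_{j=0}^{k} (-1)^(k-j) C(k,j) j^p`. -/
theorem prime_dvd_finite_difference_pow (p : ℕ) (hp : p.Prime) (k : ℕ) (hk : 2 ≤ k) :
    (p : ℤ) ∣ ∑ j ∈ Finset.range (k + 1),
      (-1 : ℤ) ^ (k - j) * (Nat.choose k j : ℤ) * (j : ℤ) ^ p := by
  haveI : Fact p.Prime := ⟨hp⟩
  have h := congrFun (fwdDiff_iter_pow_eq_zero_of_lt (R := ZMod p) (j := 1) (n := k) hk) 0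
  rw [fwdDiff_iter_eq_sum_shift] at h
  rw [← ZMod.intCast_zmod_eq_zero_iff_dvd]
  push_cast
  simpa [ZMod.pow_card] using h
end

section
/- Let K be a field and let z, a₁, a₂, ℏ ∈ K with ℏ ≠ 0 and ℏ²z ≠ 1. Let M be the 2×2 matrix over K with entries M₁₁ = a₁(z−1)/(ℏ²z−1), M₁₂ = a₂z(ℏ⁻¹−ℏ)/(ℏ²z−1), M₂₁ = a₁(ℏ⁻¹−ℏ)/(ℏ²z−1), M₂₂ = a₂(z−1)/(ℏ²z−1). Then (M − a₁·1)·(M − a₂·1) = z·ℏ²·(M − a₁ℏ⁻²·1)·(M − a₂ℏ⁻²·1), where 1 denotes the 2×2 identity matrix. -/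
/-- The quadratic relation of the quantum K-theory ring of `T*ℙ¹` (equation 1.15):
the matrix `M` of quantum multiplication by `𝒪(1)` in the stable basis satisfies
`(M - a₁)(M - a₂) = z ℏ² (M - a₁ ℏ⁻²)(M - a₂ ℏ⁻²)`. -/
theorem qK_relation_TstarP1 {K : Type*} [Field K] (z a₁ a₂ ℏ : K)
    (hℏ : ℏ ≠ 0) (hz : ℏ ^ 2 * z ≠ 1) :
    let M : Matrix (Fin 2) (Fin 2) K :=
      !![a₁ * (z - 1) / (ℏ ^ 2 * z - 1), a₂ * z * (ℏ⁻¹ - ℏ) / (ℏ ^ 2 * z - 1);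
         a₁ * (ℏ⁻¹ - ℏ) / (ℏ ^ 2 * z - 1), a₂ * (z - 1) / (ℏ ^ 2 * z - 1)]
    (M - a₁ • (1 : Matrix (Fin 2) (Fin 2) K)) * (M - a₂ • (1 : Matrix (Fin 2) (Fin 2) K))
      = (z * ℏ ^ 2) •
        ((M - (a₁ * (ℏ ^ 2)⁻¹) • (1 : Matrix (Fin 2) (Fin 2) K)) *
         (M - (a₂ * (ℏ ^ 2)⁻¹) • (1 : Matrix (Fin 2) (Fin 2) K))) := by
  intro M
  have hD : ℏ ^ 2 * z - 1 ≠ 0 := sub_ne_zero.mpr hz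
  have hD2 : z * ℏ ^ 2 - 1 ≠ 0 := by rwa [mul_comm]
  ext i j
  fin_cases i <;> fin_cases j <;>
    simp [M, Matrix.mul_apply, Fin.sum_univ_two] <;> field_simp <;> ring
end

section
/- Let p ≥ 1 be a natural number, let ζ ∈ ℂ be a primitive p-th root of unity, and let z, a₁, a₂, ℏ ∈ ℂ with ℏ ≠ 0 and ℏ²zζ^j ≠ 1 for all j = 0, 1, …, p−1. For w ∈ ℂ with ℏ²w ≠ 1 let M(w) be the 2×2 complex matrix with entries M(w)₁₁ = a₁(w−1)/(ℏ²w−1), M(w)₁₂ = a₂w(ℏ⁻¹−ℏ)/(ℏ²w−1), M(w)₂₁ = a₁(ℏ⁻¹−ℏ)/(ℏ²w−1), M(w)₂₂ = a₂(w−1)/(ℏ²w−1). Set M_p = M(z)·M(zζ)·M(zζ²)⋯M(zζ^{p−1}). Then (M_p − a₁^p·1)·(M_p − a₂^p·1) = z^p·ℏ^{2p}·(M_p − a₁^p ℏ^{−2p}·1)·(M_p − a₂^p ℏ^{−2p}·1). -/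
/-- The quantum multiplication matrix for `X = T*ℙ¹` in the stable basis. -/
noncomputable def Mqk (a₁ a₂ ℏ : ℂ) (w : ℂ) : Matrix (Fin 2) (Fin 2) ℂ :=
  !![a₁ * (w - 1) / (ℏ ^ 2 * w - 1), a₂ * w * (ℏ⁻¹ - ℏ) / (ℏ ^ 2 * w - 1);
     a₁ * (ℏ⁻¹ - ℏ) / (ℏ ^ 2 * w - 1), a₂ * (w - 1) / (ℏ ^ 2 * w - 1)]

open Finset in
lemma aux_expand {m : Type*} [Fintype m] [DecidableEq m] (A B : Matrix m m ℂ) (c : ℕ → ℂ) (n : ℕ) :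
    ∃ F : ℕ → Matrix m m ℂ, F 0 = B ^ n ∧
      F n = (∏ j ∈ range n, c j) • A ^ n ∧ (∀ i, n < i → F i = 0) ∧
      ∀ x : ℂ, ((List.range n).map (fun j => (x * c j) • A + B)).prod
        = ∑ i ∈ range (n + 1), x ^ i • F i := by
  induction n with
  | zero =>
    refine ⟨fun i => if i = 0 then 1 else 0, by simp, by simp, ?_, by simp⟩
    intro i hi
    have : i ≠ 0 := by omega
    simp [this]
  | succ n ih =>
    obtain ⟨F, h0, hn, hv, hx⟩ := ih
    refine ⟨fun i => Nat.casesOn i (F 0 * B) (fun i => c n • (F i * A) + F (i + 1) * B),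
      ?_, ?_, ?_, ?_⟩
    · simp [h0, pow_succ]
    · simp only [hn, hv (n + 1) (by omega), prod_range_succ, pow_succ]
      simp [smul_smul, mul_comm]
    · intro i hi
      obtain ⟨k, rfl⟩ : ∃ k, i = k + 1 := ⟨i - 1, by omega⟩
      simp [hv k (by omega), hv (k + 1) (by omega)]
    · intro x
      rw [List.range_succ, List.map_append, List.prod_append, hx, List.map_singleton,
        List.prod_singleton, sum_range_succ' _ (n + 1)]
      simp only [mul_add, smul_add, sum_add_distrib]
      rw [add_assoc]
      congr 1
      · rw [sum_mul]
        refine sum_congr rfl fun i _ => ?_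
        simp only [smul_mul_assoc, mul_smul_comm, smul_smul]
        congr 1
        ring
      · have h1 := sum_range_succ' (fun i => x ^ i • (F i * B)) (n + 1)
        refine Eq.trans ?_ h1
        rw [sum_range_succ _ (n + 1), hv (n + 1) (by omega), sum_mul]
        simp

lemma aux_cyc {m : Type*} [Fintype m] [DecidableEq m] (f : ℕ → Matrix m m ℂ) (p : ℕ)
    (h : f p = f 0) :
    (((List.range p).map (fun j => f (j + 1))).prod).trace
      = (((List.range p).map f).prod).trace := by
  cases p with
  | zero => simp
  | succ q =>
    conv_rhs => rw [List.range_succ_eq_map]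
    rw [List.range_succ, List.map_append, List.prod_append, Matrix.trace_mul_comm]
    simp [h, Function.comp_def]

open Finset Polynomial in
lemma aux_trace {m : Type*} [Fintype m] [DecidableEq m] (A B : Matrix m m ℂ) (p : ℕ)
    (hp : 1 ≤ p) (ζ : ℂ) (hζ : IsPrimitiveRoot ζ p) (x : ℂ) :
    (((List.range p).map (fun j => (x * ζ ^ j) • A + B)).prod).trace
      = (B ^ p).trace + x ^ p * ((∏ j ∈ range p, ζ ^ j) * (A ^ p).trace) := by
  obtain ⟨F, h0, hn, hv, hx⟩ := aux_expand A B (fun j => ζ ^ j) p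
  have hT : ∀ y : ℂ, (((List.range p).map (fun j => (y * ζ ^ j) • A + B)).prod).trace
      = ∑ i ∈ range (p + 1), y ^ i * (F i).trace := by
    intro y
    rw [hx, Matrix.trace_sum]
    simp [Matrix.trace_smul]
  have hc : ∀ y : ℂ, ∑ i ∈ range (p + 1), (y * ζ) ^ i * (F i).trace
      = ∑ i ∈ range (p + 1), y ^ i * (F i).trace := by
    intro y
    rw [← hT, ← hT, ← aux_cyc (fun j => (y * ζ ^ j) • A + B) p (by simp [hζ.pow_eq_one])]
    simp only [pow_succ', mul_assoc]
  have hpoly : (∑ i ∈ range (p + 1), C (ζ ^ i * (F i).trace) * X ^ i : ℂ[X])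
      = ∑ i ∈ range (p + 1), C ((F i).trace) * X ^ i := by
    apply Polynomial.funext
    intro y
    simp only [eval_finsetSum, eval_mul, eval_C, eval_pow, eval_X]
    have := hc y
    simp only [mul_pow] at this
    convert this using 2 <;> ring
  have hz : ∀ i, 0 < i → i < p → (F i).trace = 0 := by
    intro i hi hip
    have := congrArg (fun q => coeff q i) hpoly
    simp only [finsetSum_coeff, coeff_C_mul_X_pow, sum_ite_eq, mem_range,
      show i < p + 1 by omega, if_true] at this
    have h1 : ζ ^ i ≠ 1 := hζ.pow_ne_one_of_pos_of_lt (by omega) hip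
    have h2 : (ζ ^ i - 1) * (F i).trace = 0 := by linear_combination this
    exact (mul_eq_zero.mp h2).resolve_left (sub_ne_zero.mpr h1)
  rw [hT]
  obtain ⟨q, rfl⟩ : ∃ q, p = q + 1 := ⟨p - 1, by omega⟩
  rw [sum_range_succ, sum_range_succ', hn, h0, sum_eq_zero]
  · simp [Matrix.trace_smul]
  · intro i hi
    rw [mem_range] at hi
    rw [hz (i + 1) (by omega) (by omega), mul_zero]

lemma aux_smul_prod {m : Type*} [Fintype m] [DecidableEq m] (g : ℕ → ℂ) (f : ℕ → Matrix m m ℂ)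
    (n : ℕ) : ((List.range n).map (fun j => g j • f j)).prod
      = (∏ j ∈ Finset.range n, g j) • ((List.range n).map f).prod := by
  induction n with
  | zero => simp
  | succ n ih =>
    rw [List.range_succ, List.map_append, List.prod_append, ih, List.map_append, List.prod_append,
      Finset.prod_range_succ]
    simp [smul_smul, mul_comm]

lemma aux_det_prod {m : Type*} [Fintype m] [DecidableEq m] (f : ℕ → Matrix m m ℂ)
    (n : ℕ) : (((List.range n).map f).prod).det = ∏ j ∈ Finset.range n, (f j).det := by
  induction n with
  | zero => simp
  | succ n ih =>
    rw [List.range_succ, List.map_append, List.prod_append, Matrix.det_mul, ih,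
      Finset.prod_range_succ]
    simp

open Finset in
lemma aux_D0 (p : ℕ) (hp : 1 ≤ p) (ζ : ℂ) (hζ : IsPrimitiveRoot ζ p) (x : ℂ) :
    ∏ j ∈ range p, (x * ζ ^ j - 1) = (-1) ^ p + x ^ p * ∏ j ∈ range p, ζ ^ j := by
  have h := aux_trace (1 : Matrix (Fin 1) (Fin 1) ℂ) ((-1 : ℂ) • 1) p hp ζ hζ x
  have e : (fun j => (x * ζ ^ j) • (1 : Matrix (Fin 1) (Fin 1) ℂ) + (-1 : ℂ) • 1)
      = fun j => (x * ζ ^ j - 1) • (fun _ : ℕ => (1 : Matrix (Fin 1) (Fin 1) ℂ)) j := by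
    funext j
    rw [← add_smul, sub_eq_add_neg]
  rw [e, aux_smul_prod] at h
  rw [smul_pow] at h
  simpa only [one_pow, Matrix.trace_smul, Matrix.trace_one, Fintype.card_fin, Nat.cast_one,
    smul_eq_mul, mul_one, List.map_const', List.prod_replicate] using h

open Finset in
lemma aux_s (p : ℕ) (hp : 1 ≤ p) (ζ : ℂ) (hζ : IsPrimitiveRoot ζ p) :
    ∏ j ∈ range p, ζ ^ j = -(-1) ^ p := by
  have h := aux_D0 p hp ζ hζ 1
  rw [prod_eq_zero (mem_range.mpr (show 0 < p by omega)) (by simp)] at h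
  linear_combination -h

lemma aux_A (a b k : ℂ) (n : ℕ) : ((!![a, k; 0, b] : Matrix (Fin 2) (Fin 2) ℂ) ^ n).trace
    = a ^ n + b ^ n := by
  have : ∃ t, (!![a, k; 0, b] : Matrix (Fin 2) (Fin 2) ℂ) ^ n = !![a ^ n, t; 0, b ^ n] := by
    induction n with
    | zero => exact ⟨0, by simp [Matrix.one_fin_two]⟩
    | succ n ih =>
      obtain ⟨t, ht⟩ := ih
      exact ⟨a ^ n * k + t * b, by rw [pow_succ, ht]; simp [Matrix.mul_fin_two, pow_succ]⟩
  obtain ⟨t, ht⟩ := this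
  simp [ht, Matrix.trace_fin_two]

lemma aux_B (a b k : ℂ) (n : ℕ) : ((!![a, 0; k, b] : Matrix (Fin 2) (Fin 2) ℂ) ^ n).trace
    = a ^ n + b ^ n := by
  rw [← aux_A a b k n, ← Matrix.trace_transpose, Matrix.transpose_pow]
  congr 2
  ext i j
  fin_cases i <;> fin_cases j <;> rfl

lemma aux_final (M : Matrix (Fin 2) (Fin 2) ℂ) (α β u H : ℂ) (hH : H ≠ 0)
    (ht : (1 - u * H) * M.trace = (α + β) * (1 - u))
    (hd : (1 - u * H) * M.det = α * β * (1 - u * H⁻¹)) :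
    (M - α • (1 : Matrix (Fin 2) (Fin 2) ℂ)) * (M - β • (1 : Matrix (Fin 2) (Fin 2) ℂ))
    = (u * H) • ((M - (α * H⁻¹) • (1 : Matrix (Fin 2) (Fin 2) ℂ))
      * (M - (β * H⁻¹) • (1 : Matrix (Fin 2) (Fin 2) ℂ))) := by
  have hi : H * H⁻¹ = 1 := mul_inv_cancel₀ hH
  have hCH : M * M = M.trace • M - M.det • 1 := by
    ext i j
    fin_cases i <;> fin_cases j <;>
      simp [Matrix.mul_apply, Fin.sum_univ_two, Matrix.trace_fin_two, Matrix.det_fin_two] <;> ring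
  simp only [sub_mul, mul_sub, hCH, smul_mul_assoc, mul_smul_comm, one_mul, mul_one]
  generalize M.trace = t at *
  generalize M.det = d at *
  generalize H⁻¹ = K at *
  ext i j
  simp only [Matrix.sub_apply, Matrix.smul_apply, smul_eq_mul]
  generalize M i j = e
  generalize (1 : Matrix (Fin 2) (Fin 2) ℂ) i j = o
  linear_combination e * ht - o * hd + (u * (α + β) * e - u * K * α * β * o) * hi

/-- Equation (1.16) of the paper: the iterated product
`M_p = M(z) M(zζ) ⋯ M(zζ^{p-1})` at a primitive `p`-th root of unity `ζ` satisfies the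
quantum K-theory relation of `T*ℙ¹` with all parameters raised to their `p`-th powers. -/
theorem qK_relation_TstarP1_root_of_unity (p : ℕ) (hp : 1 ≤ p) (ζ : ℂ)
    (hζ : IsPrimitiveRoot ζ p) (z a₁ a₂ ℏ : ℂ) (hℏ : ℏ ≠ 0)
    (hz : ∀ j < p, ℏ ^ 2 * (z * ζ ^ j) ≠ 1) :
    let Mp : Matrix (Fin 2) (Fin 2) ℂ :=
      ((List.range p).map (fun j => Mqk a₁ a₂ ℏ (z * ζ ^ j))).prod
    (Mp - (a₁ ^ p) • (1 : Matrix (Fin 2) (Fin 2) ℂ))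
        * (Mp - (a₂ ^ p) • (1 : Matrix (Fin 2) (Fin 2) ℂ))
      = (z ^ p * ℏ ^ (2 * p)) •
        ((Mp - (a₁ ^ p * (ℏ ^ (2 * p))⁻¹) • (1 : Matrix (Fin 2) (Fin 2) ℂ))
          * (Mp - (a₂ ^ p * (ℏ ^ (2 * p))⁻¹) • (1 : Matrix (Fin 2) (Fin 2) ℂ))) := by
  intro Mp
  have hH : ℏ ^ (2 * p) ≠ 0 := pow_ne_zero _ hℏ
  have hD : ∀ x : ℂ, ∏ j ∈ Finset.range p, (x * ζ ^ j - 1) = (-1) ^ p * (1 - x ^ p) := by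
    intro x
    rw [aux_D0 p hp ζ hζ x, aux_s p hp ζ hζ]
    ring
  have hDz := hD (ℏ ^ 2 * z)
  have hDne : ∏ j ∈ Finset.range p, (ℏ ^ 2 * z * ζ ^ j - 1) ≠ 0 := by
    rw [Finset.prod_ne_zero_iff]
    intro j hj
    rw [mul_assoc]
    exact sub_ne_zero.mpr (hz j (Finset.mem_range.mp hj))
  have hm : ((-1 : ℂ) ^ p) * (-1) ^ p = 1 := by
    rw [← mul_pow]
    simp
  have hpw : (ℏ ^ 2 * z) ^ p = z ^ p * ℏ ^ (2 * p) := by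
    rw [mul_pow, ← pow_mul, mul_comm]
  rw [hpw] at hDz
  apply aux_final _ _ _ _ _ hH
  · have e : (fun j => Mqk a₁ a₂ ℏ (z * ζ ^ j)) = fun j => (ℏ ^ 2 * z * ζ ^ j - 1)⁻¹ •
        (fun j => (z * ζ ^ j) • !![a₁, a₂ * (ℏ⁻¹ - ℏ); 0, a₂]
          + !![-a₁, 0; a₁ * (ℏ⁻¹ - ℏ), -a₂]) j := by
      funext j
      ext i k
      fin_cases i <;> fin_cases k <;> simp [Mqk] <;> ring
    have h1 : Mp.trace = (∏ j ∈ Finset.range p, (ℏ ^ 2 * z * ζ ^ j - 1))⁻¹ *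
        ((-1) ^ p * (a₁ ^ p + a₂ ^ p) * (1 - z ^ p)) := by
      simp only [Mp]
      rw [e, aux_smul_prod, Matrix.trace_smul, aux_trace _ _ p hp ζ hζ, aux_A, aux_B,
        aux_s p hp ζ hζ, Finset.prod_inv_distrib, smul_eq_mul, neg_pow a₁, neg_pow a₂]
      ring
    have h2 : (∏ j ∈ Finset.range p, (ℏ ^ 2 * z * ζ ^ j - 1)) * Mp.trace =
        (-1) ^ p * (a₁ ^ p + a₂ ^ p) * (1 - z ^ p) := by
      rw [h1, mul_inv_cancel_left₀ hDne]
    rw [hDz] at h2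
    linear_combination (-1) ^ p * h2 +
      ((a₁ ^ p + a₂ ^ p) * (1 - z ^ p) - (1 - z ^ p * ℏ ^ (2 * p)) * Mp.trace) * hm
  · have h3 : (∏ j ∈ Finset.range p, (ℏ ^ 2 * z * ζ ^ j - 1)) * Mp.det =
        (a₁ * a₂) ^ p * ∏ j ∈ Finset.range p, ((ℏ ^ 2)⁻¹ * z * ζ ^ j - 1) := by
      simp only [Mp]
      rw [aux_det_prod, ← Finset.prod_mul_distrib]
      conv_rhs => rw [← Finset.card_range p, ← Finset.prod_const, Finset.card_range,
        ← Finset.prod_mul_distrib]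
      refine Finset.prod_congr rfl fun j hj => ?_
      have hne := sub_ne_zero.mpr (hz j (Finset.mem_range.mp hj))
      rw [mul_assoc (ℏ ^ 2) z, mul_assoc (ℏ ^ 2)⁻¹ z]
      simp only [Mqk, Matrix.det_fin_two_of]
      generalize z * ζ ^ j = w at *
      field_simp
      ring
    rw [hDz, hD, mul_pow (ℏ ^ 2)⁻¹, inv_pow, ← pow_mul, mul_pow] at h3
    linear_combination (-1) ^ p * h3 + (a₁ ^ p * a₂ ^ p * (1 - z ^ p * (ℏ ^ (2 * p))⁻¹)
      - (1 - z ^ p * ℏ ^ (2 * p)) * Mp.det) * hm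
end
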